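/- arXiv:2301.05062 — 13 statements merged into one kernel-verified Lean document; each statement's English description precedes it below -/
import Mathlib

section
/- Let α, β, γ, δ be finite nonempty types and let p_A : α → γ → Prop and p_B : β → δ → Prop be predicates. Suppose blocks F : α → γ → ℝ, G : α → δ → ℝ, H : β → γ → ℝ, K : β → δ → ℝ implement the OR of p_A and p_B in the saturated-attention sense. If p_B is non-constant, i.e. there exist b₁ ∈ β, d₁ ∈ δ with p_B b₁ d₁ and b₀ ∈ β, d₀ ∈ δ with ¬ p_B b₀ d₀, then p_A is rank-1: there exist u : α → Prop and v : γ → Prop such that for all a ∈ α and c ∈ γ, p_A a c ↔ (u a ∧ v c). -/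
/-- The blocks `F, G, H, K` of a direct attention matrix implement the OR of the
predicates `pA` and `pB` in the saturated-attention sense: for every query `(a, b)`
whose selected set `{(c, d) | pA a c ∨ pB b d}` is nonempty, the selected set equals
the argmax set of the logits `L(a,b,c,d) = F a c + G a d + H b c + K b d`. -/
def ImplementsOr {α β γ δ : Type*} (pA : α → γ → Prop) (pB : β → δ → Prop)
    (F : α → γ → ℝ) (G : α → δ → ℝ) (H : β → γ → ℝ) (K : β → δ → ℝ) : Prop :=
  ∀ a b, (∃ c d, pA a c ∨ pB b d) →
    ∀ c d, (pA a c ∨ pB b d) ↔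
      ∀ c' d', F a c' + G a d' + H b c' + K b d' ≤ F a c + G a d + H b c + K b d

theorem stmt_0 {α β γ δ : Type*}
    [Fintype α] [Fintype β] [Fintype γ] [Fintype δ]
    [Nonempty α] [Nonempty β] [Nonempty γ] [Nonempty δ]
    (pA : α → γ → Prop) (pB : β → δ → Prop)
    (F : α → γ → ℝ) (G : α → δ → ℝ) (H : β → γ → ℝ) (K : β → δ → ℝ)
    (himpl : ImplementsOr pA pB F G H K)
    (b₁ : β) (d₁ : δ) (hB1 : pB b₁ d₁)
    (b₀ : β) (d₀ : δ) (hB0 : ¬ pB b₀ d₀) :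
    ∃ (u : α → Prop) (v : γ → Prop), ∀ a c, pA a c ↔ (u a ∧ v c) := by
  have hc : ∀ a c c', F a c + H b₁ c ≤ F a c' + H b₁ c' := by
    intro a c c'
    have h := (himpl a b₁ ⟨c', d₁, Or.inr hB1⟩ c' d₁).1 (Or.inr hB1) c d₁
    linarith
  refine ⟨fun a => ∃ c, pA a c, fun c => ∀ c', H b₀ c' - H b₁ c' ≤ H b₀ c - H b₁ c, ?_⟩
  intro a c
  constructor
  · intro h
    refine ⟨⟨c, h⟩, fun c' => ?_⟩
    have h1 := (himpl a b₀ ⟨c, d₀, Or.inl h⟩ c d₀).1 (Or.inl h) c' d₀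
    have h2 := hc a c c'
    linarith
  · rintro ⟨⟨e, he⟩, hv⟩
    have h1 := (himpl a b₀ ⟨e, d₀, Or.inl he⟩ e d₀).1 (Or.inl he)
    have h2 : pA a c ∨ pB b₀ d₀ := by
      refine (himpl a b₀ ⟨e, d₀, Or.inl he⟩ c d₀).2 fun c' d' => ?_
      have h3 := h1 c' d'
      have h4 := hv e
      have h5 := hc a e c
      linarith
    exact h2.resolve_right hB0
end

section
/- Let α, β, γ, δ be finite nonempty types and let p_A : α → γ → Prop and p_B : β → δ → Prop be predicates. Suppose blocks F : α → γ → ℝ, G : α → δ → ℝ, H : β → γ → ℝ, K : β → δ → ℝ implement the OR of p_A and p_B in the saturated-attention sense. Then either p_A is constant (it holds for all pairs in α × γ or fails for all pairs in α × γ), or p_B is constant (it holds for all pairs in β × δ or fails for all pairs in β × δ), or both p_A and p_B are rank-1. -/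
/-- A predicate `p : α → γ → Prop` is rank-1 if it factors as a conjunction of a
predicate on queries and a predicate on keys. -/
def Rank1 {α γ : Type*} (p : α → γ → Prop) : Prop :=
  ∃ (u : α → Prop) (v : γ → Prop), ∀ a c, p a c ↔ (u a ∧ v c)

theorem implOr_swap {α β γ δ : Type*} {pA : α → γ → Prop} {pB : β → δ → Prop}
    {F : α → γ → ℝ} {G : α → δ → ℝ} {H : β → γ → ℝ} {K : β → δ → ℝ}
    (h : ImplementsOr pA pB F G H K) : ImplementsOr pB pA K H G F := by
  intro b a ⟨d, c, hx⟩ d c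
  have := h a b ⟨_, _, hx.symm⟩ c d
  rw [or_comm, this]
  constructor
  · intro h1 d' c'
    linarith [h1 c' d']
  · intro h1 c' d'
    linarith [h1 d' c']

theorem rank1_of_rows {α γ : Type*} {p : α → γ → Prop}
    (h : ∀ a c c', p a c → p a c') : Rank1 p :=
  ⟨fun a => ∃ c, p a c, fun _ => True, fun a c =>
    ⟨fun hp => ⟨⟨c, hp⟩, trivial⟩, fun ⟨⟨c', hp⟩, _⟩ => h a c' c hp⟩⟩

theorem rank1_of_key {α β γ δ : Type*} [Nonempty δ] {pA : α → γ → Prop} {pB : β → δ → Prop}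
    {F : α → γ → ℝ} {G : α → δ → ℝ} {H : β → γ → ℝ} {K : β → δ → ℝ}
    (h : ImplementsOr pA pB F G H K) (b0 b1 : β) (h0 : ∀ d, ¬ pB b0 d) (h1 : ∀ d, pB b1 d) :
    Rank1 pA := by
  obtain ⟨d⟩ := ‹Nonempty δ›
  have hc : ∀ a c c', F a c + H b1 c ≤ F a c' + H b1 c' := by
    intro a c c'
    have := (h a b1 ⟨c, d, Or.inr (h1 d)⟩ c' d).1 (Or.inr (h1 d)) c d
    linarith
  refine ⟨fun a => ∃ c, pA a c, fun c => ∃ a, pA a c, fun a c =>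
    ⟨fun hp => ⟨⟨c, hp⟩, ⟨a, hp⟩⟩, ?_⟩⟩
  rintro ⟨⟨c1, hp⟩, ⟨a', hp'⟩⟩
  have e1 := (h a b0 ⟨c1, d, Or.inl hp⟩ c1 d).1 (Or.inl hp)
  have e2 := (h a' b0 ⟨c, d, Or.inl hp'⟩ c d).1 (Or.inl hp') c1 d
  refine ((h a b0 ⟨c1, d, Or.inl hp⟩ c d).2 ?_).resolve_right (h0 d)
  intro c' d'
  linarith [e1 c' d', hc a c c1, hc a c1 c, hc a' c c1, hc a' c1 c]

theorem rows_of_mixed {α β γ δ : Type*} {pA : α → γ → Prop} {pB : β → δ → Prop}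
    {F : α → γ → ℝ} {G : α → δ → ℝ} {H : β → γ → ℝ} {K : β → δ → ℝ}
    (h : ImplementsOr pA pB F G H K) (a : α) (c c' : γ) (hc : pA a c) (hc' : ¬ pA a c') :
    ∀ b d d', pB b d → pB b d' := by
  intro b d d' hd
  have e1 := (h a b ⟨c, d, Or.inl hc⟩ c d').1 (Or.inl hc)
  have e2 := (h a b ⟨c, d, Or.inl hc⟩ c' d).1 (Or.inr hd) c d
  refine ((h a b ⟨c, d, Or.inl hc⟩ c' d').2 ?_).resolve_left hc'
  intro x y
  linarith [e1 x y]

theorem stmt_1 {α β γ δ : Type*}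
    [Fintype α] [Fintype β] [Fintype γ] [Fintype δ]
    [Nonempty α] [Nonempty β] [Nonempty γ] [Nonempty δ]
    (pA : α → γ → Prop) (pB : β → δ → Prop)
    (F : α → γ → ℝ) (G : α → δ → ℝ) (H : β → γ → ℝ) (K : β → δ → ℝ)
    (himpl : ImplementsOr pA pB F G H K) :
    ((∀ a c, pA a c) ∨ (∀ a c, ¬ pA a c)) ∨
    ((∀ b d, pB b d) ∨ (∀ b d, ¬ pB b d)) ∨
    (Rank1 pA ∧ Rank1 pB) := by
  by_contra hcon
  simp only [not_or] at hcon
  obtain ⟨⟨hA1, hA2⟩, ⟨hB1, hB2⟩, hR⟩ := hcon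
  push Not at hA1 hA2 hB1 hB2
  obtain ⟨a0, c0, ha0⟩ := hA1
  obtain ⟨a1, c1, ha1⟩ := hA2
  obtain ⟨b0, d0, hb0⟩ := hB1
  obtain ⟨b1, d1, hb1⟩ := hB2
  apply hR
  by_cases hM : ∀ a c c', pA a c → pA a c'
  · exact ⟨rank1_of_rows hM, rank1_of_key (implOr_swap himpl) a0 a1
      (fun c hc => ha0 (hM _ _ _ hc)) (fun c => hM _ _ _ ha1)⟩
  · push Not at hM
    obtain ⟨a, c, c', hc, hc'⟩ := hM
    have hN := rows_of_mixed himpl a c c' hc hc'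
    exact ⟨rank1_of_key himpl b0 b1
      (fun d hd => hb0 (hN _ _ _ hd)) (fun d => hN _ _ _ hb1), rank1_of_rows hN⟩
end

section
/- Let α, β, γ, δ be finite nonempty types and let p_A : α → γ → Prop and p_B : β → δ → Prop be predicates. Suppose blocks F : α → γ → ℝ, G : α → δ → ℝ, H : β → γ → ℝ, K : β → δ → ℝ implement the OR of p_A and p_B in the saturated-attention sense, and suppose there exist b₁ ∈ β and d₁ ∈ δ with p_B b₁ d₁. Then for all a ∈ α and all c, c' ∈ γ, F a c + H b₁ c = F a c' + H b₁ c'. -/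
theorem stmt_2 {α β γ δ : Type*}
    [Fintype α] [Fintype β] [Fintype γ] [Fintype δ]
    [Nonempty α] [Nonempty β] [Nonempty γ] [Nonempty δ]
    (pA : α → γ → Prop) (pB : β → δ → Prop)
    (F : α → γ → ℝ) (G : α → δ → ℝ) (H : β → γ → ℝ) (K : β → δ → ℝ)
    (himpl : ImplementsOr pA pB F G H K)
    (b₁ : β) (d₁ : δ) (hB1 : pB b₁ d₁) :
    ∀ (a : α) (c c' : γ), F a c + H b₁ c = F a c' + H b₁ c' := by
  intro a c c'
  have h := himpl a b₁ ⟨c, d₁, Or.inr hB1⟩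
  have h1 := (h c d₁).1 (Or.inr hB1) c' d₁
  have h2 := (h c' d₁).1 (Or.inr hB1) c d₁
  linarith
end

section
/- Let α, β, γ, δ be finite nonempty types and let p_A : α → γ → Prop and p_B : β → δ → Prop be predicates. Suppose blocks F : α → γ → ℝ, G : α → δ → ℝ, H : β → γ → ℝ, K : β → δ → ℝ implement the OR of p_A and p_B in the saturated-attention sense, and suppose there exist b₁ ∈ β and d₁ ∈ δ with p_B b₁ d₁. Then the logit differences over keys are independent of the query: for all a, a' ∈ α and all c, c' ∈ γ, F a c − F a c' = F a' c − F a' c'. -/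
theorem stmt_3 {α β γ δ : Type*}
    [Fintype α] [Fintype β] [Fintype γ] [Fintype δ]
    [Nonempty α] [Nonempty β] [Nonempty γ] [Nonempty δ]
    (pA : α → γ → Prop) (pB : β → δ → Prop)
    (F : α → γ → ℝ) (G : α → δ → ℝ) (H : β → γ → ℝ) (K : β → δ → ℝ)
    (himpl : ImplementsOr pA pB F G H K)
    (b₁ : β) (d₁ : δ) (hB1 : pB b₁ d₁) :
    ∀ (a a' : α) (c c' : γ), F a c - F a c' = F a' c - F a' c' := by
  intro a a' c c'
  have key : ∀ x, F x c + H b₁ c = F x c' + H b₁ c' := by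
    intro x
    have h := himpl x b₁ ⟨c, d₁, Or.inr hB1⟩
    have h1 := (h c d₁).1 (Or.inr hB1) c' d₁
    have h2 := (h c' d₁).1 (Or.inr hB1) c d₁
    linarith
  have h1 := key a
  have h2 := key a'
  linarith
end

section
/- Let α, β, γ, δ be finite nonempty types and let p_A : α → γ → Prop and p_B : β → δ → Prop be predicates. Suppose blocks F : α → γ → ℝ, G : α → δ → ℝ, H : β → γ → ℝ, K : β → δ → ℝ implement the OR of p_A and p_B in the saturated-attention sense, and suppose there exist b₀ ∈ β and d₀ ∈ δ with ¬ p_B b₀ d₀. Then for every a ∈ α such that the row {c ∈ γ : p_A a c} is nonempty, this row equals the argmax set {c ∈ γ : for all c' ∈ γ, F a c' + H b₀ c' ≤ F a c + H b₀ c}. -/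
theorem stmt_4 {α β γ δ : Type*}
    [Fintype α] [Fintype β] [Fintype γ] [Fintype δ]
    [Nonempty α] [Nonempty β] [Nonempty γ] [Nonempty δ]
    (pA : α → γ → Prop) (pB : β → δ → Prop)
    (F : α → γ → ℝ) (G : α → δ → ℝ) (H : β → γ → ℝ) (K : β → δ → ℝ)
    (himpl : ImplementsOr pA pB F G H K)
    (b₀ : β) (d₀ : δ) (hB0 : ¬ pB b₀ d₀) :
    ∀ a : α, {c : γ | pA a c}.Nonempty →
      {c : γ | pA a c} = {c : γ | ∀ c' : γ, F a c' + H b₀ c' ≤ F a c + H b₀ c} := by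
  rintro a ⟨c₀, hc₀⟩
  have hc₀' : pA a c₀ := hc₀
  have h := himpl a b₀ ⟨c₀, d₀, Or.inl hc₀'⟩
  ext c
  simp only [Set.mem_setOf_eq]
  constructor
  · intro hc c'
    have := (h c d₀).1 (Or.inl hc) c' d₀
    linarith
  · intro hc
    refine ((h c d₀).2 fun c' d' => ?_).resolve_right hB0
    have h1 := (h c₀ d₀).1 (Or.inl hc₀') c' d'
    have h2 := hc c₀
    linarith
end

section
/- Let ι be a finite nonempty type and ℓ : ι → ℝ a logit vector. Let M = max_{i ∈ ι} ℓ i and let S = {j ∈ ι : ℓ j = M} be the argmax set. Then for every j ∈ ι, as β → ∞ the softmax weight softmax(β·ℓ)_j converges to 1/|S| if ℓ j = M, and converges to 0 otherwise. -/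
open Filter Topology

theorem stmt_7 {ι : Type*} [Fintype ι] [Nonempty ι] (ℓ : ι → ℝ)
    (M : ℝ) (hM : M = Finset.univ.sup' Finset.univ_nonempty ℓ)
    (S : Finset ι) (hS : S = Finset.univ.filter fun j => ℓ j = M) (j : ι) :
    Tendsto (fun β : ℝ => Real.exp (β * ℓ j) / ∑ i, Real.exp (β * ℓ i)) atTop
      (𝓝 (if ℓ j = M then 1 / (S.card : ℝ) else 0)) := by
  have hle : ∀ i, ℓ i ≤ M := fun i => by
    rw [hM]; exact Finset.le_sup' ℓ (Finset.mem_univ i)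
  have key : ∀ i, Tendsto (fun β : ℝ => Real.exp (β * (ℓ i - M))) atTop
      (𝓝 (if ℓ i = M then (1 : ℝ) else 0)) := by
    intro i
    split_ifs with h
    · simp [h]
    · have hlt : ℓ i - M < 0 := sub_neg.mpr (lt_of_le_of_ne (hle i) h)
      exact Real.tendsto_exp_atBot.comp (tendsto_id.atTop_mul_const_of_neg hlt)
  have hsum : Tendsto (fun β : ℝ => ∑ i, Real.exp (β * (ℓ i - M))) atTop
      (𝓝 (S.card : ℝ)) := by
    have h := tendsto_finsetSum Finset.univ (fun i _ => key i)
    rw [Finset.sum_boole, ← hS] at h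
    exact h
  have hne : (S.card : ℝ) ≠ 0 := by
    obtain ⟨k, -, hk⟩ := Finset.exists_mem_eq_sup' (Finset.univ_nonempty (α := ι)) ℓ
    have : k ∈ S := by rw [hS]; simp [hM, hk]
    exact_mod_cast Finset.card_ne_zero_of_mem this
  have h := (key j).div hsum hne
  have e : (if ℓ j = M then 1 / (S.card : ℝ) else 0)
      = (if ℓ j = M then (1 : ℝ) else 0) / (S.card : ℝ) := by
    split_ifs <;> simp
  rw [e]
  refine h.congr fun β => ?_
  simp only [Pi.div_apply, mul_sub, Real.exp_sub]
  rw [← Finset.sum_div, div_div_div_cancel_right₀ (Real.exp_ne_zero _)]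
end

section
/- Let ι be a finite nonempty type, ℓ : ι → ℝ a logit vector and s : ι → ℝ a value vector. Let M = max_{i ∈ ι} ℓ i and let S = {j ∈ ι : ℓ j = M} be the argmax set. Then as β → ∞, the attention output ∑_{j ∈ ι} softmax(β·ℓ)_j · s j converges to the average (∑_{j ∈ S} s j) / |S| of the values over the argmax set. -/
open Filter Topology

theorem stmt_8 {ι : Type*} [Fintype ι] [Nonempty ι] (ℓ : ι → ℝ) (s : ι → ℝ)
    (M : ℝ) (hM : M = Finset.univ.sup' Finset.univ_nonempty ℓ)
    (S : Finset ι) (hS : S = Finset.univ.filter fun j => ℓ j = M) :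
    Tendsto
      (fun β : ℝ => ∑ j, (Real.exp (β * ℓ j) / ∑ i, Real.exp (β * ℓ i)) * s j)
      atTop (𝓝 ((∑ j ∈ S, s j) / (S.card : ℝ))) := by
  have hle : ∀ j, ℓ j ≤ M := fun j => by
    rw [hM]; exact Finset.le_sup' ℓ (Finset.mem_univ j)
  obtain ⟨j0, -, hj0⟩ := Finset.exists_mem_eq_sup' (Finset.univ_nonempty (α := ι)) ℓ
  have hmem : j0 ∈ S := by
    rw [hS, Finset.mem_filter]
    exact ⟨Finset.mem_univ _, by rw [hM, hj0]⟩
  have hcard : (S.card : ℝ) ≠ 0 := by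
    exact_mod_cast (Finset.card_pos.mpr ⟨j0, hmem⟩).ne'
  have key : ∀ j, Tendsto (fun β : ℝ => Real.exp (β * (ℓ j - M))) atTop
      (𝓝 (if ℓ j = M then 1 else 0)) := by
    intro j
    split_ifs with h
    · simp [h]
    · have hlt : ℓ j - M < 0 := sub_neg.mpr (lt_of_le_of_ne (hle j) h)
      exact Real.tendsto_exp_atBot.comp (tendsto_id.atTop_mul_const_of_neg hlt)
  have hnum : Tendsto (fun β : ℝ => ∑ j, Real.exp (β * (ℓ j - M)) * s j) atTop
      (𝓝 (∑ j ∈ S, s j)) := by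
    have := tendsto_finsetSum Finset.univ (fun j _ => (key j).mul_const (s j))
    convert this using 2
    rw [hS, Finset.sum_filter]
    exact Finset.sum_congr rfl fun j _ => by split_ifs <;> simp
  have hden : Tendsto (fun β : ℝ => ∑ j, Real.exp (β * (ℓ j - M))) atTop
      (𝓝 (S.card : ℝ)) := by
    have := tendsto_finsetSum Finset.univ (fun j _ => key j)
    convert this using 2
    rw [hS, Finset.sum_boole]
  refine (hnum.div hden hcard).congr fun β => ?_
  have e : ∀ j, Real.exp (β * ℓ j) = Real.exp (β * M) * Real.exp (β * (ℓ j - M)) := by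
    intro j
    rw [← Real.exp_add]; congr 1; ring
  simp only [e, Pi.div_apply]
  rw [← Finset.mul_sum, Finset.sum_div]
  refine Finset.sum_congr rfl fun j _ => ?_
  rw [mul_div_mul_left _ _ (Real.exp_pos _).ne']
  ring
end

section
/- Let ι be a finite type with |ι| = n ≥ 1 and let ℓ : ι → ℝ be a binary logit vector. Suppose m = |{j ∈ ι : ℓ j = 1}| ≥ 1. Then for every β ≥ 0 and every j ∈ ι, | softmax(β·ℓ)_j − (if ℓ j = 1 then 1/m else 0) | ≤ (n/m²)·exp(−β). -/
theorem stmt_9 {ι : Type*} [Fintype ι] (n : ℕ) (hn : Fintype.card ι = n) (hn1 : 1 ≤ n)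
    (ℓ : ι → ℝ) (hbin : ∀ j, ℓ j = 0 ∨ ℓ j = 1)
    (m : ℕ) (hm : m = (Finset.univ.filter fun j => ℓ j = 1).card) (hm1 : 1 ≤ m) :
    ∀ β : ℝ, 0 ≤ β → ∀ j : ι,
      |Real.exp (β * ℓ j) / (∑ i, Real.exp (β * ℓ i)) -
          (if ℓ j = 1 then 1 / (m : ℝ) else 0)| ≤
        ((n : ℝ) / (m : ℝ) ^ 2) * Real.exp (-β) := by
  intro β hβ j
  have hE : 1 ≤ Real.exp β := Real.one_le_exp hβ
  have hZ : (∑ i, Real.exp (β * ℓ i)) = (n : ℝ) + m * (Real.exp β - 1) := by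
    have h1 : ∀ i, Real.exp (β * ℓ i) = 1 + if ℓ i = 1 then (Real.exp β - 1) else 0 := by
      intro i
      rcases hbin i with h | h <;> simp [h]
    rw [Finset.sum_congr rfl (fun i _ => h1 i), Finset.sum_add_distrib, ← Finset.sum_filter,
      Finset.sum_const, Finset.sum_const, ← hm, Finset.card_univ, hn]
    simp
  have hmn : m ≤ n := by
    rw [hm, ← hn]
    exact Finset.card_le_univ _
  have hmn' : (m : ℝ) ≤ n := by exact_mod_cast hmn
  have hm' : (1 : ℝ) ≤ m := by exact_mod_cast hm1
  rw [hZ, Real.exp_neg]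
  have hZE : (m : ℝ) * Real.exp β ≤ n + m * (Real.exp β - 1) := by linarith
  have hmE : 0 < (m : ℝ) * Real.exp β := by positivity
  have hZ0 : 0 < (n : ℝ) + m * (Real.exp β - 1) := by linarith
  have hm0 : (0 : ℝ) < m := by linarith
  have hE0 : 0 < Real.exp β := by positivity
  have hR : (n : ℝ) / (m : ℝ) ^ 2 * (Real.exp β)⁻¹ = n / (m * (m * Real.exp β)) := by
    field_simp
  rw [hR]
  rcases hbin j with h | h
  · simp only [h, mul_zero, Real.exp_zero, zero_ne_one, if_false, sub_zero]
    rw [abs_of_pos (by positivity), div_le_div_iff₀ hZ0 (by positivity), one_mul]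
    exact mul_le_mul hmn' hZE hmE.le (by linarith)
  · simp only [h, mul_one, if_true]
    have e : Real.exp β / (n + m * (Real.exp β - 1)) - 1 / (m : ℝ)
        = -((n - m) / (m * (n + m * (Real.exp β - 1)))) := by
      field_simp
      ring
    rw [e, abs_neg, abs_of_nonneg (div_nonneg (by linarith) (by positivity))]
    apply div_le_div₀ (by linarith) (by linarith) (by positivity)
    exact mul_le_mul_of_nonneg_left hZE hm0.le
end

section
/- Let ι be a finite nonempty type and u, v : ι → ℝ two binary logit vectors, and suppose S = {j ∈ ι : u j = 1 ∧ v j = 1} is nonempty. Then for every j ∈ ι, as β → ∞ the softmax weight softmax(β·(u + v))_j converges to 1/|S| if j ∈ S, and converges to 0 otherwise. Thus summing the direct attention matrices of two selectors implements their AND in the low-temperature limit. -/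
open Filter Topology

theorem stmt_11 {ι : Type*} [Fintype ι] [DecidableEq ι] [Nonempty ι] (u v : ι → ℝ)
    (hu : ∀ j, u j = 0 ∨ u j = 1) (hv : ∀ j, v j = 0 ∨ v j = 1)
    (S : Finset ι) (hS : S = Finset.univ.filter fun j => u j = 1 ∧ v j = 1)
    (hne : S.Nonempty) (j : ι) :
    Tendsto
      (fun β : ℝ => Real.exp (β * (u + v) j) / ∑ i, Real.exp (β * (u + v) i)) atTop
      (𝓝 (if j ∈ S then 1 / (S.card : ℝ) else 0)) := by
  have key : ∀ i, Tendsto (fun β : ℝ => Real.exp (β * ((u + v) i - 2))) atTop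
      (𝓝 (if i ∈ S then (1 : ℝ) else 0)) := by
    intro i
    have hmem : i ∈ S ↔ (u i = 1 ∧ v i = 1) := by simp [hS]
    by_cases h : i ∈ S
    · obtain ⟨h1, h2⟩ := hmem.1 h
      have h3 : (u + v) i - 2 = 0 := by rw [Pi.add_apply, h1, h2]; norm_num
      simp only [h3, if_pos h, mul_zero, Real.exp_zero, tendsto_const_nhds]
    · have hneg : (u + v) i - 2 < 0 := by
        rw [Pi.add_apply]
        rcases hu i with h1 | h1 <;> rcases hv i with h2 | h2
        · rw [h1, h2]; norm_num
        · rw [h1, h2]; norm_num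
        · rw [h1, h2]; norm_num
        · exact absurd (hmem.2 ⟨h1, h2⟩) h
      rw [if_neg h]
      exact Real.tendsto_exp_atBot.comp (tendsto_id.atTop_mul_const_of_neg hneg)
  have hsum : Tendsto (fun β : ℝ => ∑ i, Real.exp (β * ((u + v) i - 2))) atTop
      (𝓝 (S.card : ℝ)) := by
    have h := tendsto_finsetSum (Finset.univ : Finset ι) (fun i _ => key i)
    simpa using h
  have hc : (S.card : ℝ) ≠ 0 := by
    exact_mod_cast hne.card_pos.ne'
  have h := (key j).div hsum hc
  have e : (if j ∈ S then 1 / (S.card : ℝ) else 0) = (if j ∈ S then (1 : ℝ) else 0) / S.card := by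
    split_ifs <;> simp
  rw [e]
  refine h.congr fun β => ?_
  have hx : ∀ i, Real.exp (β * ((u + v) i - 2)) = Real.exp (β * (u + v) i) * Real.exp (-(β * 2)) := by
    intro i
    rw [← Real.exp_add]
    congr 1
    ring
  simp only [Pi.div_apply, hx]
  rw [← Finset.sum_mul, mul_div_mul_right _ _ (Real.exp_ne_zero _)]
end

section
/- Let ι be a finite nonempty type and u, v : ι → ℝ two binary logit vectors, and suppose S = {j ∈ ι : u j = 0 ∧ v j = 0} is nonempty. Then for every j ∈ ι, as β → ∞ the softmax weight softmax(β·(−u − v))_j converges to 1/|S| if j ∈ S, and converges to 0 otherwise. Thus negating the sum of the direct attention matrices of two selectors implements their NOR in the low-temperature limit. -/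
open Filter Topology

theorem stmt_12 {ι : Type*} [Fintype ι] [DecidableEq ι] [Nonempty ι] (u v : ι → ℝ)
    (hu : ∀ j, u j = 0 ∨ u j = 1) (hv : ∀ j, v j = 0 ∨ v j = 1)
    (S : Finset ι) (hS : S = Finset.univ.filter fun j => u j = 0 ∧ v j = 0)
    (hne : S.Nonempty) (j : ι) :
    Tendsto
      (fun β : ℝ => Real.exp (β * (-u - v) j) / ∑ i, Real.exp (β * (-u - v) i)) atTop
      (𝓝 (if j ∈ S then 1 / (S.card : ℝ) else 0)) := by
  have key : ∀ i, Tendsto (fun β : ℝ => Real.exp (β * (-u - v) i)) atTop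
      (𝓝 (if i ∈ S then (1 : ℝ) else 0)) := by
    intro i
    by_cases hi : i ∈ S
    · have h0 : u i = 0 ∧ v i = 0 := by simpa [hS] using hi
      simp [hi, h0.1, h0.2]
    · have h0 : ¬ (u i = 0 ∧ v i = 0) := by simpa [hS] using hi
      rw [if_neg hi]
      have hneg : (-u - v) i < 0 := by
        simp only [Pi.sub_apply, Pi.neg_apply]
        rcases hu i with h | h <;> rcases hv i with h' | h' <;> rw [h, h'] <;> norm_num
        exact h0 ⟨h, h'⟩
      exact Real.tendsto_exp_atBot.comp (tendsto_id.atTop_mul_const_of_neg hneg)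
  have hsum : Tendsto (fun β : ℝ => ∑ i, Real.exp (β * (-u - v) i)) atTop
      (𝓝 (S.card : ℝ)) := by
    have h := tendsto_finsetSum Finset.univ (fun i _ => key i)
    simpa using h
  have hc : (S.card : ℝ) ≠ 0 := by
    exact_mod_cast hne.card_pos.ne'
  have h := (key j).div hsum hc
  have e : (if j ∈ S then 1 / (S.card : ℝ) else 0) = (if j ∈ S then (1 : ℝ) else 0) / (S.card : ℝ) := by
    split_ifs <;> simp
  rw [e]
  exact h
end

section
/- Let n ≥ 1 and let u, v : Fin (n+1) → ℝ be binary on nonzero positions (u j, v j ∈ {0,1} for all j ≠ 0). Define logits ℓ : Fin (n+1) → ℝ by ℓ 0 = 3/2 (the BOS offset) and ℓ j = u j + v j for j ≠ 0, and let S = {j ≠ 0 : u j = 1 ∧ v j = 1}. Then as β → ∞: if S is nonempty, softmax(β·ℓ)_j converges to 1/|S| for j ∈ S and to 0 for all other positions (including BOS); if S is empty, softmax(β·ℓ)_0 converges to 1 and all other weights converge to 0. Thus with BOS offset 3/2, the head attends uniformly to positions where both selectors are active, and attends to BOS exactly when no such position exists. -/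
open Filter Topology

theorem softmax_aux {m : ℕ} (ℓ : Fin m → ℝ) (M : ℝ) (T : Finset (Fin m)) (hT : T.Nonempty)
    (h1 : ∀ j ∈ T, ℓ j = M) (h2 : ∀ j, j ∉ T → ℓ j < M) (j : Fin m) :
    Tendsto (fun β : ℝ => Real.exp (β * ℓ j) / ∑ i, Real.exp (β * ℓ i)) atTop
        (𝓝 (if j ∈ T then 1 / (T.card : ℝ) else 0)) := by
  have key : ∀ i, Tendsto (fun β : ℝ => Real.exp (β * (ℓ i - M))) atTop
      (𝓝 (if i ∈ T then 1 else 0)) := by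
    intro i
    by_cases hi : i ∈ T
    · simp [hi, h1 i hi]
    · rw [if_neg hi]
      exact Real.tendsto_exp_atBot.comp
        (tendsto_id.atTop_mul_const_of_neg (sub_neg.2 (h2 i hi)))
  have hsum : Tendsto (fun β : ℝ => ∑ i, Real.exp (β * (ℓ i - M))) atTop (𝓝 (T.card : ℝ)) := by
    have := tendsto_finsetSum Finset.univ (fun i _ => key i)
    simpa using this
  have hc : (T.card : ℝ) ≠ 0 := by exact_mod_cast hT.card_pos.ne'
  have h := (key j).div hsum hc
  have e : (if j ∈ T then 1 / (T.card : ℝ) else 0) = (if j ∈ T then 1 else 0) / (T.card : ℝ) := by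
    split_ifs <;> simp
  rw [e]
  refine h.congr fun β => ?_
  have e2 : ∀ i, Real.exp (β * (ℓ i - M)) = Real.exp (β * ℓ i) / Real.exp (β * M) := by
    intro i
    rw [← Real.exp_sub, mul_sub]
  simp only [Pi.div_apply, e2, ← Finset.sum_div]
  exact div_div_div_cancel_right₀ (Real.exp_pos _).ne' _ _

theorem stmt_13 (n : ℕ) (hn : 1 ≤ n) (u v : Fin (n + 1) → ℝ)
    (hu : ∀ j : Fin (n + 1), j ≠ 0 → u j = 0 ∨ u j = 1)
    (hv : ∀ j : Fin (n + 1), j ≠ 0 → v j = 0 ∨ v j = 1)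
    (ℓ : Fin (n + 1) → ℝ) (hℓ0 : ℓ 0 = 3 / 2)
    (hℓ : ∀ j : Fin (n + 1), j ≠ 0 → ℓ j = u j + v j)
    (S : Finset (Fin (n + 1)))
    (hS : S = Finset.univ.filter fun j => j ≠ 0 ∧ u j = 1 ∧ v j = 1) :
    (S.Nonempty → ∀ j : Fin (n + 1),
      Tendsto (fun β : ℝ => Real.exp (β * ℓ j) / ∑ i, Real.exp (β * ℓ i)) atTop
        (𝓝 (if j ∈ S then 1 / (S.card : ℝ) else 0))) ∧
    (S = ∅ → ∀ j : Fin (n + 1),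
      Tendsto (fun β : ℝ => Real.exp (β * ℓ j) / ∑ i, Real.exp (β * ℓ i)) atTop
        (𝓝 (if j = 0 then 1 else 0))) := by
  constructor
  · intro hne j
    refine softmax_aux ℓ 2 S hne ?_ ?_ j
    · intro i hi
      simp only [hS, Finset.mem_filter, Finset.mem_univ, true_and] at hi
      rw [hℓ i hi.1, hi.2.1, hi.2.2]; norm_num
    · intro i hi
      simp only [hS, Finset.mem_filter, Finset.mem_univ, true_and] at hi
      by_cases h0 : i = 0
      · rw [h0, hℓ0]; norm_num
      · rw [hℓ i h0]
        rcases hu i h0 with a | a <;> rcases hv i h0 with b | b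
        · rw [a, b]; norm_num
        · rw [a, b]; norm_num
        · rw [a, b]; norm_num
        · exact absurd ⟨h0, a, b⟩ hi
  · intro he j
    have h := softmax_aux ℓ (3 / 2) {0} (Finset.singleton_nonempty _) (by simpa using hℓ0) ?_ j
    · simpa using h
    · intro i hi
      have h0 : i ≠ 0 := by simpa using hi
      have hiS : i ∉ S := by simp [he]
      simp only [hS, Finset.mem_filter, Finset.mem_univ, true_and] at hiS
      rw [hℓ i h0]
      rcases hu i h0 with a | a <;> rcases hv i h0 with b | b
      · rw [a, b]; norm_num
      · rw [a, b]; norm_num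
      · rw [a, b]; norm_num
      · exact absurd ⟨h0, a, b⟩ hiS
end

section
/- Let n ≥ 1 and let ℓ : Fin (n+1) → ℝ satisfy ℓ 0 = 1 (the BOS offset) and ℓ j ∈ {0,1} for j ≠ 0, and let S = {j ≠ 0 : ℓ j = 1} be the set of selected positions. Then as β → ∞, for every j ∈ Fin (n+1), softmax(β·ℓ)_j converges to 1/(1 + |S|) if j = 0 or j ∈ S, and converges to 0 otherwise. Thus with BOS offset 1, the BOS token is always attended to, uniformly together with the selected positions. -/
open Filter Topology

theorem stmt_15 (n : ℕ) (hn : 1 ≤ n) (ℓ : Fin (n + 1) → ℝ)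
    (hℓ0 : ℓ 0 = 1)
    (hℓ : ∀ j : Fin (n + 1), j ≠ 0 → ℓ j = 0 ∨ ℓ j = 1)
    (S : Finset (Fin (n + 1)))
    (hS : S = Finset.univ.filter fun j => j ≠ 0 ∧ ℓ j = 1) :
    ∀ j : Fin (n + 1),
      Tendsto (fun β : ℝ => Real.exp (β * ℓ j) / ∑ i, Real.exp (β * ℓ i)) atTop
        (𝓝 (if j = 0 ∨ j ∈ S then 1 / (1 + (S.card : ℝ)) else 0)) := by
  intro j
  have key : ∀ i : Fin (n + 1), Tendsto (fun β : ℝ => Real.exp (β * ℓ i) * Real.exp (-β)) atTop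
      (𝓝 (if i = 0 ∨ i ∈ S then (1 : ℝ) else 0)) := by
    intro i
    have h01 : (ℓ i = 1 ∧ (i = 0 ∨ i ∈ S)) ∨ (ℓ i = 0 ∧ ¬ (i = 0 ∨ i ∈ S)) := by
      by_cases hi : i = 0
      · left
        exact ⟨by rw [hi, hℓ0], Or.inl hi⟩
      · rcases hℓ i hi with h | h
        · right
          simp [hS, hi, h]
        · left
          simp [hS, hi, h]
    rcases h01 with ⟨h, hc⟩ | ⟨h, hc⟩
    · rw [if_pos hc]
      simp [h, ← Real.exp_add]
    · rw [if_neg hc]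
      simpa [h] using Real.tendsto_exp_neg_atTop_nhds_zero
  have hsum := tendsto_finsetSum Finset.univ (fun i _ => key i)
  have h0S : (0 : Fin (n + 1)) ∉ S := by simp [hS]
  have hcard : ∑ i : Fin (n + 1), (if i = 0 ∨ i ∈ S then (1 : ℝ) else 0) = 1 + (S.card : ℝ) := by
    rw [Finset.sum_boole]
    have : (Finset.univ.filter fun i : Fin (n + 1) => i = 0 ∨ i ∈ S) = insert 0 S := by
      ext i
      simp
    rw [this, Finset.card_insert_of_notMem h0S]
    push_cast
    ring
  rw [hcard] at hsum
  have hdiv := (key j).div hsum (by positivity)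
  have e : (if j = 0 ∨ j ∈ S then 1 / (1 + (S.card : ℝ)) else 0)
      = (if j = 0 ∨ j ∈ S then (1 : ℝ) else 0) / (1 + (S.card : ℝ)) := by
    split_ifs <;> simp
  rw [e]
  refine hdiv.congr (fun β => ?_)
  simp only [Pi.div_apply]
  rw [← Finset.sum_mul, mul_div_mul_right _ _ (Real.exp_ne_zero _)]
end

section
/- Let n ≥ 1 and let ℓ : Fin (n+1) → ℝ satisfy ℓ 0 = 1 (the BOS offset) and ℓ j ∈ {0,1} for j ≠ 0, and let S = {j ≠ 0 : ℓ j = 1} be the set of selected positions. Let the value vector s : Fin (n+1) → ℝ be s 0 = 1 and s j = 0 for j ≠ 0. Then as β → ∞, the attention output ∑_{j} softmax(β·ℓ)_j · s j converges to x = 1/(1 + |S|), and consequently 1/x − 1 = |S|. Thus an attention head attending to BOS together with the selected positions, with value 1 at BOS, computes the selector width |S| up to the invertible map w ↦ 1/(1+w). -/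
open Filter Topology

theorem stmt_16 (n : ℕ) (hn : 1 ≤ n) (ℓ : Fin (n + 1) → ℝ)
    (hℓ0 : ℓ 0 = 1)
    (hℓ : ∀ j : Fin (n + 1), j ≠ 0 → ℓ j = 0 ∨ ℓ j = 1)
    (S : Finset (Fin (n + 1)))
    (hS : S = Finset.univ.filter fun j => j ≠ 0 ∧ ℓ j = 1)
    (s : Fin (n + 1) → ℝ) (hs0 : s 0 = 1)
    (hs : ∀ j : Fin (n + 1), j ≠ 0 → s j = 0) :
    Tendsto
      (fun β : ℝ => ∑ j, (Real.exp (β * ℓ j) / ∑ i, Real.exp (β * ℓ i)) * s j)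
      atTop (𝓝 (1 / (1 + (S.card : ℝ)))) ∧
    1 / (1 / (1 + (S.card : ℝ))) - 1 = (S.card : ℝ) := by
  have hpos : (0 : ℝ) < 1 + (S.card : ℝ) := by positivity
  refine ⟨?_, by field_simp; ring⟩
  have hsum : (∑ i, if ℓ i = 1 then (1 : ℝ) else 0) = 1 + (S.card : ℝ) := by
    have h1 : (Finset.univ.filter fun j => ℓ j = 1) = insert 0 S := by
      ext j
      simp only [hS, Finset.mem_filter, Finset.mem_univ, true_and, Finset.mem_insert]
      by_cases hj : j = 0
      · simp [hj, hℓ0]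
      · simp [hj]
    have h0 : (0 : Fin (n + 1)) ∉ S := by simp [hS]
    rw [Finset.sum_boole, h1, Finset.card_insert_of_notMem h0]
    push_cast
    ring
  have hlim : Tendsto (fun β : ℝ => ∑ i, Real.exp (β * (ℓ i - 1))) atTop
      (𝓝 (1 + (S.card : ℝ))) := by
    rw [← hsum]
    refine tendsto_finsetSum _ fun i _ => ?_
    by_cases h : ℓ i = 1
    · simp [h]
    · have hi : i ≠ 0 := fun h' => h (h' ▸ hℓ0)
      have h0 : ℓ i = 0 := (hℓ i hi).resolve_right h
      simpa [h0] using Real.tendsto_exp_neg_atTop_nhds_zero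
  have hfun : (fun β : ℝ => ∑ j, (Real.exp (β * ℓ j) / ∑ i, Real.exp (β * ℓ i)) * s j)
      = fun β : ℝ => 1 / ∑ i, Real.exp (β * (ℓ i - 1)) := by
    funext β
    rw [Finset.sum_eq_single 0 (fun j _ hj => by rw [hs j hj, mul_zero]) (by simp),
      hs0, hℓ0, mul_one, mul_one]
    have : ∑ i, Real.exp (β * ℓ i) = Real.exp β * ∑ i, Real.exp (β * (ℓ i - 1)) := by
      rw [Finset.mul_sum]
      refine Finset.sum_congr rfl fun i _ => ?_
      rw [← Real.exp_add]
      congr 1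
      ring
    rw [this, ← div_div, div_self (Real.exp_pos β).ne']
  rw [hfun]
  exact tendsto_const_nhds.div hlim hpos.ne'
end
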